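/- arXiv:2405.02044 — 5 statements merged into one kernel-verified Lean document; each statement's English description precedes it below -/
import Mathlib

section
/- For every compact set D ⊆ ℝ^n and every ε > 0 there exists δ > 0 with the following property: for every partition Δ of [τ,T] with d(Δ) ≤ δ, every index i ∈ {0,…,m}, every x ∈ D, u ∈ 𝒰, v ∈ 𝒱, setting r = Δt_i f⁰(t_i,x,u,v) and x' = x + Δt_i f(t_i,x,u,v), one has |Q^Δ(t_i,x,u,v) − r − inf_{u'∈𝒰} sup_{v'∈𝒱} Q^Δ(t_{i+1},x',u',v')| ≤ Δt_i ε. -/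
open scoped RealInnerProductSpace

noncomputable section

/-- `En n` is ℝ^n. -/
abbrev En (n : ℕ) : Type := EuclideanSpace ℝ (Fin n)

/-- χ(t,x,u,v,s) = ⟨f(t,x,u,v), s⟩ + f⁰(t,x,u,v). -/
def chi {n k l : ℕ} (f : ℝ → En n → En k → En l → En n)
    (f0 : ℝ → En n → En k → En l → ℝ)
    (t : ℝ) (x : En n) (u : En k) (v : En l) (s : En n) : ℝ :=
  ⟪f t x u v, s⟫ + f0 t x u v

/-- Hamiltonian H(t,x,s) = inf_{u∈𝒰} sup_{v∈𝒱} χ(t,x,u,v,s). -/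
def ham {n k l : ℕ} (U : Set (En k)) (Vs : Set (En l))
    (f : ℝ → En n → En k → En l → En n) (f0 : ℝ → En n → En k → En l → ℝ)
    (t : ℝ) (x s : En n) : ℝ :=
  ⨅ u : U, ⨆ v : Vs, chi f f0 t x u.1 v.1 s

/-- Q^Δ(t_i,x,u,v) = V(t_i,x) + Δt_i (∂_t V(t_i,x) + χ(t_i,x,u,v,∇_x V(t_i,x))) for i ≤ m,
and Q^Δ(t_{m+1},x,u,v) = σ(x). -/
def Qdelta {n k l : ℕ} (f : ℝ → En n → En k → En l → En n)
    (f0 : ℝ → En n → En k → En l → ℝ) (σ : En n → ℝ) (V : ℝ → En n → ℝ)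
    (ts : ℕ → ℝ) (m i : ℕ) (x : En n) (u : En k) (v : En l) : ℝ :=
  if i ≤ m then
    V (ts i) x + (ts (i + 1) - ts i) *
      (deriv (fun r => V r x) (ts i) +
        chi f f0 (ts i) x u v (gradient (V (ts i)) x))
  else σ x

/-- A `C¹` function is differentiable uniformly on compact sets. -/
theorem ContDiff.exists_forall_norm_sub_fderiv_le {E F : Type*}
    [NormedAddCommGroup E] [NormedSpace ℝ E] [NormedAddCommGroup F] [NormedSpace ℝ F]
    {g : E → F} (hg : ContDiff ℝ 1 g) {K : Set E} (hK : IsCompact K) {ε : ℝ} (hε : 0 < ε) :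
    ∃ δ > 0, ∀ p ∈ K, ∀ h : E, ‖h‖ < δ → ‖g (p + h) - g p - fderiv ℝ g p h‖ ≤ ε * ‖h‖ := by
  have hcont : Continuous (fderiv ℝ g) := hg.continuous_fderiv one_ne_zero
  have hunif := hK.uniformContinuousAt_of_continuousAt (fderiv ℝ g)
    (fun p _ => hcont.continuousAt) (Metric.dist_mem_uniformity hε)
  obtain ⟨δ, hδ, H⟩ := Metric.mem_uniformity_dist.1 hunif
  refine ⟨δ, hδ, fun p hp h hh => ?_⟩
  have hmv := (convex_ball p δ).norm_image_sub_le_of_norm_fderiv_le' (𝕜 := ℝ) (f := g)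
    (φ := fderiv ℝ g p) (C := ε) (x := p) (y := p + h)
    (fun q _ => hg.differentiable one_ne_zero q)
    (fun q hq => by
      have hpq := H (a := p) (b := q) (by rwa [dist_comm]) hp
      rw [← dist_eq_norm, dist_comm]
      exact hpq.le)
    (Metric.mem_ball_self hδ) (by simpa using hh)
  simpa using hmv

/-- An infimum of suprema of a bounded family commutes with nonnegative affine maps. -/
theorem Real.iInf_iSup_add_mul {ι κ : Type*} [Nonempty ι] [Nonempty κ] {g : ι → κ → ℝ} {C : ℝ}
    (hg : ∀ i j, |g i j| ≤ C) (a b : ℝ) {c : ℝ} (hc : 0 ≤ c) :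
    ⨅ i, ⨆ j, (a + c * (b + g i j)) = a + c * (b + ⨅ i, ⨆ j, g i j) := by
  have hbdd (i : ι) : BddAbove (Set.range (g i)) := by
    refine ⟨C, ?_⟩
    rintro _ ⟨j, rfl⟩
    exact (abs_le.1 (hg i j)).2
  have hbdd_sup : BddBelow (Set.range fun i => ⨆ j, g i j) := by
    refine ⟨-C, ?_⟩
    rintro _ ⟨i, rfl⟩
    exact (abs_le.1 (hg i (Classical.arbitrary κ))).1.trans (le_ciSup (hbdd i) _)
  have hmono : Monotone fun r : ℝ => a + c * (b + r) := fun r s hrs => by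
    dsimp only
    gcongr
  have hcont : Continuous fun r : ℝ => a + c * (b + r) := by fun_prop
  calc ⨅ i, ⨆ j, (a + c * (b + g i j)) = ⨅ i, (a + c * (b + ⨆ j, g i j)) :=
        iInf_congr fun i => (hmono.map_ciSup_of_continuousAt hcont.continuousAt (hbdd i)).symm
    _ = a + c * (b + ⨅ i, ⨆ j, g i j) :=
        (hmono.map_ciInf_of_continuousAt hcont.continuousAt hbdd_sup).symm

/-- The Fréchet derivative of a function of time and space, in terms of its time derivative and
its spatial gradient. -/
theorem fderiv_uncurry_apply {E : Type*} [NormedAddCommGroup E] [InnerProductSpace ℝ E]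
    [CompleteSpace E] {V : ℝ → E → ℝ} {t : ℝ} {x : E}
    (hV : DifferentiableAt ℝ (Function.uncurry V) (t, x)) (a : ℝ) (y : E) :
    fderiv ℝ (Function.uncurry V) (t, x) (a, y) =
      a * deriv (fun r => V r x) t + ⟪y, gradient (V t) x⟫ := by
  have htime : HasDerivAt (fun r => V r x) (fderiv ℝ (Function.uncurry V) (t, x) (1, 0)) t :=
    hV.hasFDerivAt.comp_hasDerivAt (f := fun r => (r, x)) t
      ((hasDerivAt_id t).prodMk (hasDerivAt_const t x))
  have hspace : HasFDerivAt (V t)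
      ((fderiv ℝ (Function.uncurry V) (t, x)).comp (ContinuousLinearMap.inr ℝ ℝ E)) x :=
    hV.hasFDerivAt.comp x (hasFDerivAt_prodMk_right t x)
  rw [htime.deriv, real_inner_comm, gradient, InnerProductSpace.toDual_symm_apply, hspace.fderiv,
    ← smul_eq_mul, ← map_smul, ContinuousLinearMap.comp_apply, ← map_add]
  simp

/-- For a solution of the Hamilton–Jacobi–Isaacs equation, the value of the game with payoff
`Qdelta` at a node of the partition is `V`. -/
theorem iInf_iSup_Qdelta {n k l : ℕ} {T : ℝ} {U : Set (En k)} {Vs : Set (En l)}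
    (hUc : IsCompact U) (hUne : U.Nonempty) (hVc : IsCompact Vs) (hVne : Vs.Nonempty)
    {f : ℝ → En n → En k → En l → En n} {f0 : ℝ → En n → En k → En l → ℝ}
    (hf : Continuous fun p : ℝ × En n × En k × En l => f p.1 p.2.1 p.2.2.1 p.2.2.2)
    (hf0 : Continuous fun p : ℝ × En n × En k × En l => f0 p.1 p.2.1 p.2.2.1 p.2.2.2)
    {σ : En n → ℝ} {V : ℝ → En n → ℝ}
    (hHJI : ∀ t ∈ Set.Ico (0:ℝ) T, ∀ x : En n,
      deriv (fun r => V r x) t + ham U Vs f f0 t x (gradient (V t) x) = 0)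
    (hVT : ∀ x : En n, V T x = σ x) {m : ℕ} {ts : ℕ → ℝ} {i : ℕ} (h0 : 0 ≤ ts i)
    (hT : ts (m + 1) = T) (hi : i ≤ m + 1) (hlt : i ≤ m → ts i < T ∧ ts i ≤ ts (i + 1))
    (x : En n) :
    ⨅ u : U, ⨆ v : Vs, Qdelta f f0 σ V ts m i x u.1 v.1 = V (ts i) x := by
  have : Nonempty U := hUne.to_subtype
  have : Nonempty Vs := hVne.to_subtype
  by_cases him : i ≤ m
  · obtain ⟨hiT, hstep⟩ := hlt him
    have hcont : Continuous fun p : En k × En l =>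
        chi f f0 (ts i) x p.1 p.2 (gradient (V (ts i)) x) := by
      unfold chi
      have hemb : Continuous fun p : En k × En l => (ts i, x, p.1, p.2) := by fun_prop
      exact ((hf.comp hemb).inner continuous_const).add (hf0.comp hemb)
    obtain ⟨C, hC⟩ := (hUc.prod hVc).exists_bound_of_continuousOn hcont.continuousOn
    have hbound (u : U) (v : Vs) :
        |chi f f0 (ts i) x u.1 v.1 (gradient (V (ts i)) x)| ≤ C :=
      hC (u.1, v.1) ⟨u.2, v.2⟩
    simp only [Qdelta, if_pos him]
    rw [Real.iInf_iSup_add_mul hbound _ _ (sub_nonneg.2 hstep)]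
    have hzero := hHJI (ts i) ⟨h0, hiT⟩ x
    rw [ham] at hzero
    rw [hzero, mul_zero, add_zero]
  · obtain rfl : i = m + 1 := by omega
    simp [Qdelta, hT, hVT]

theorem stmt_0
    (n k l : ℕ) (hn : 0 < n) (hk : 0 < k) (hl : 0 < l)
    (T : ℝ) (hT : 0 < T)
    (U : Set (En k)) (Vs : Set (En l))
    (hUc : IsCompact U) (hUne : U.Nonempty) (hVc : IsCompact Vs) (hVne : Vs.Nonempty)
    (f : ℝ → En n → En k → En l → En n) (f0 : ℝ → En n → En k → En l → ℝ)
    (hf : Continuous fun p : ℝ × En n × En k × En l => f p.1 p.2.1 p.2.2.1 p.2.2.2)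
    (hf0 : Continuous fun p : ℝ × En n × En k × En l => f0 p.1 p.2.1 p.2.2.1 p.2.2.2)
    (σ : En n → ℝ) (hσ : Continuous σ)
    (V : ℝ → En n → ℝ) (hV : ContDiff ℝ 1 (Function.uncurry V))
    (hHJI : ∀ t ∈ Set.Ico (0:ℝ) T, ∀ x : En n,
      deriv (fun r => V r x) t + ham U Vs f f0 t x (gradient (V t) x) = 0)
    (hVT : ∀ x : En n, V T x = σ x)
    (τ : ℝ) (hτ0 : 0 ≤ τ) (hτT : τ < T)
    (D : Set (En n)) (hD : IsCompact D) (ε : ℝ) (hε : 0 < ε) :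
    ∃ δ > 0, ∀ (m : ℕ) (ts : ℕ → ℝ),
      ts 0 = τ → ts (m + 1) = T → (∀ i ≤ m, ts i < ts (i + 1)) →
      (∀ i ≤ m, ts (i + 1) - ts i ≤ δ) →
      ∀ i ≤ m, ∀ x ∈ D, ∀ u ∈ U, ∀ v ∈ Vs,
        |Qdelta f f0 σ V ts m i x u v - (ts (i + 1) - ts i) * f0 (ts i) x u v -
            ⨅ u' : U, ⨆ v' : Vs,
              Qdelta f f0 σ V ts m (i + 1)
                (x + (ts (i + 1) - ts i) • f (ts i) x u v) u'.1 v'.1| ≤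
          (ts (i + 1) - ts i) * ε := by
  obtain ⟨M, hM⟩ := (isCompact_Icc.prod (hD.prod (hUc.prod hVc)) :
    IsCompact (Set.Icc (0:ℝ) T ×ˢ D ×ˢ U ×ˢ Vs)).exists_bound_of_continuousOn hf.continuousOn
  set B : ℝ := 1 + |M|
  have hB : 0 < B := by positivity
  obtain ⟨η, hη, H⟩ := hV.exists_forall_norm_sub_fderiv_le
    ((isCompact_Icc (a := (0:ℝ)) (b := T)).prod hD) (div_pos hε hB)
  refine ⟨η / (2 * B), by positivity, fun m ts h0 hT1 hlt hmesh i hi x hx u hu v hv => ?_⟩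
  have hmono : StrictMonoOn ts (Set.Iic (m + 1)) :=
    strictMonoOn_of_lt_succ Set.ordConnected_Iic fun j _ _ hj => hlt j (by simpa using hj)
  have hnonneg {j : ℕ} (hj : j ≤ m + 1) : 0 ≤ ts j :=
    hτ0.trans (h0 ▸ hmono.monotoneOn (Nat.zero_le (m + 1)) hj (Nat.zero_le j))
  have hltT {j : ℕ} (hj : j ≤ m) : ts j < T :=
    hT1 ▸ hmono (show j ≤ m + 1 by omega) (le_refl (m + 1)) (by omega)
  rw [iInf_iSup_Qdelta hUc hUne hVc hVne hf hf0 hHJI hVT (hnonneg (by omega)) hT1 (by omega)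
    fun h => ⟨hltT h, (hlt _ h).le⟩, Qdelta, if_pos hi]
  have hstep : 0 < ts (i + 1) - ts i := sub_pos.2 (hlt i hi)
  set d := ts (i + 1) - ts i with hd
  have hti : ts i ∈ Set.Icc 0 T := ⟨hnonneg (by omega), (hltT hi).le⟩
  set y := f (ts i) x u v with hy
  have hyM : ‖y‖ ≤ |M| := (hM (ts i, x, u, v) ⟨hti, hx, hu, hv⟩).trans (le_abs_self M)
  have hnorm : ‖(d, d • y)‖ ≤ d * B := by
    rw [Prod.norm_def, norm_smul, Real.norm_of_nonneg hstep.le]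
    exact max_le (le_mul_of_one_le_right hstep.le (by simp [B]))
      (mul_le_mul_of_nonneg_left (by simp only [B]; linarith) hstep.le)
  have hsmall : ‖(d, d • y)‖ < η := by
    refine hnorm.trans_lt ?_
    have hdB := mul_le_mul_of_nonneg_right (hmesh i hi) hB.le
    have hhalf : η / (2 * B) * B = η / 2 := by field_simp
    rw [← hd] at hdB
    linarith
  have hest := H (ts i, x) ⟨hti, hx⟩ (d, d • y) hsmall
  rw [fderiv_uncurry_apply (hV.differentiable one_ne_zero _), real_inner_smul_left,
    Prod.mk_add_mk, hd, add_sub_cancel, ← hd, Real.norm_eq_abs, abs_sub_comm] at hest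
  simp only [Function.uncurry_apply_pair] at hest
  calc _ = |d * deriv (fun r => V r x) (ts i) + d * ⟪y, gradient (V (ts i)) x⟫ -
        (V (ts (i + 1)) (x + d • y) - V (ts i) x)| := by
        rw [chi, ← hy]
        congr 1
        ring
    _ ≤ ε / B * ‖(d, d • y)‖ := hest
    _ ≤ ε / B * (d * B) := by gcongr
    _ = d * ε := by field_simp
end
end

section
/- Assume Isaacs's condition holds. Then for every compact set D ⊆ ℝ^n and every ε > 0 there exists δ > 0 with the following property: for every partition Δ of [τ,T] with d(Δ) ≤ δ, every index i ∈ {0,…,m}, every x ∈ D, u ∈ 𝒰, v ∈ 𝒱, setting r = Δt_i f⁰(t_i,x,u,v) and x' = x + Δt_i f(t_i,x,u,v), one has |Q^Δ(t_i,x,u,v) − r − sup_{v'∈𝒱} inf_{u'∈𝒰} Q^Δ(t_{i+1},x',u',v')| ≤ Δt_i ε. -/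
open scoped RealInnerProductSpace

noncomputable section

/-- First-order Taylor expansion of a `C¹` map, with a remainder uniform over base points in a
compact set. -/
theorem ContDiff.exists_uniform_taylor_bound {E F : Type*} [NormedAddCommGroup E] [NormedSpace ℝ E]
    [NormedAddCommGroup F] [NormedSpace ℝ F] {g : E → F} (hg : ContDiff ℝ 1 g)
    {K : Set E} (hK : IsCompact K) {η : ℝ} (hη : 0 < η) :
    ∃ ρ > 0, ∀ p ∈ K, ∀ h : E, ‖h‖ < ρ → ‖g (p + h) - g p - fderiv ℝ g p h‖ ≤ η * ‖h‖ := by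
  have hc : Continuous (fderiv ℝ g) := hg.continuous_fderiv one_ne_zero
  have hU := hK.uniformContinuousAt_of_continuousAt (fderiv ℝ g)
    (fun a _ => hc.continuousAt) (Metric.dist_mem_uniformity hη)
  obtain ⟨ρ, hρ, hρU⟩ := Metric.mem_uniformity_dist.1 hU
  refine ⟨ρ, hρ, fun p hp h hh => ?_⟩
  have key := (convex_ball p ρ).norm_image_sub_le_of_norm_fderiv_le' (𝕜 := ℝ) (f := g)
    (φ := fderiv ℝ g p) (C := η) (x := p) (y := p + h)
    (fun q _ => (hg.differentiable one_ne_zero) q)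
    (fun q hq => by
      have h1 := hρU (a := p) (b := q) (by rw [dist_comm]; exact hq) hp
      rw [← dist_eq_norm, dist_comm]
      exact le_of_lt h1)
    (Metric.mem_ball_self hρ) (by simpa [Metric.mem_ball, dist_eq_norm] using hh)
  simpa using key

/-- The total derivative of a function of time and space, in terms of its time derivative and
spatial gradient. -/
theorem fderiv_uncurry_apply_smul {n : ℕ} {V : ℝ → En n → ℝ}
    {t : ℝ} {x : En n} (hV : DifferentiableAt ℝ (Function.uncurry V) (t, x)) (c : ℝ) (w : En n) :
    fderiv ℝ (Function.uncurry V) (t, x) (c, c • w) =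
      c * (deriv (fun r => V r x) t + ⟪w, gradient (V t) x⟫) := by
  have h := hV.hasFDerivAt
  have h1 : HasDerivAt (fun r => V r x) (fderiv ℝ (Function.uncurry V) (t, x) (1, 0)) t :=
    HasFDerivAt.comp_hasDerivAt (f := fun r : ℝ => (r, x)) t h
      ((hasDerivAt_id t).prodMk (hasDerivAt_const t x))
  have h2 : HasFDerivAt (V t) ((fderiv ℝ (Function.uncurry V) (t, x)).comp
      (ContinuousLinearMap.inr ℝ ℝ (En n))) x :=
    HasFDerivAt.comp (f := fun y : En n => (t, y)) x h (hasFDerivAt_prodMk_right t x)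
  have h3 : ⟪w, gradient (V t) x⟫ = fderiv ℝ (Function.uncurry V) (t, x) (0, w) := by
    rw [real_inner_comm, gradient, InnerProductSpace.toDual_symm_apply, h2.fderiv]
    simp
  have h4 : ((c, c • w) : ℝ × En n) = c • ((1, 0) + (0, w)) := by simp
  rw [h1.deriv, h3, h4, map_smul, map_add, smul_eq_mul]

/-- A positive affine map commutes with the lower value of a bounded payoff. -/
theorem iSup_iInf_add_mul {α β : Type*} [Nonempty α] [Nonempty β] {g : α → β → ℝ} {C : ℝ}
    (hg : ∀ a b, |g a b| ≤ C) (a c : ℝ) (hc : 0 ≤ c) :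
    ⨆ y, ⨅ z, (a + c * g y z) = a + c * ⨆ y, ⨅ z, g y z := by
  have hb : ∀ y, BddBelow (Set.range fun z => g y z) := fun y =>
    ⟨-C, by rintro _ ⟨z, rfl⟩; exact (abs_le.1 (hg y z)).1⟩
  have h1 : ∀ y, ⨅ z, (a + c * g y z) = a + c * ⨅ z, g y z := fun y => by
    rw [Real.mul_iInf_of_nonneg hc, add_ciInf]
    refine ⟨c * -C, ?_⟩
    rintro _ ⟨z, rfl⟩
    exact mul_le_mul_of_nonneg_left (abs_le.1 (hg y z)).1 hc
  simp_rw [h1]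
  rw [Real.mul_iSup_of_nonneg hc, add_ciSup]
  refine ⟨c * C, ?_⟩
  rintro _ ⟨y, rfl⟩
  refine mul_le_mul_of_nonneg_left ?_ hc
  exact (ciInf_le (hb y) (Classical.arbitrary β)).trans (abs_le.1 (hg y _)).2

/-- Under Isaacs's condition and the Hamilton–Jacobi–Isaacs equation, the lower value of
`Qdelta` at a partition point is the value function there. -/
theorem iSup_iInf_Qdelta {n k l : ℕ} {T : ℝ} {U : Set (En k)} {Vs : Set (En l)}
    (hUc : IsCompact U) (hUne : U.Nonempty) (hVc : IsCompact Vs) (hVne : Vs.Nonempty)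
    {f : ℝ → En n → En k → En l → En n} {f0 : ℝ → En n → En k → En l → ℝ}
    (hf : Continuous fun p : ℝ × En n × En k × En l => f p.1 p.2.1 p.2.2.1 p.2.2.2)
    (hf0 : Continuous fun p : ℝ × En n × En k × En l => f0 p.1 p.2.1 p.2.2.1 p.2.2.2)
    (hIsaacs : ∀ t ∈ Set.Icc (0:ℝ) T, ∀ x s : En n,
      (⨅ u : U, ⨆ v : Vs, chi f f0 t x u.1 v.1 s) =
        ⨆ v : Vs, ⨅ u : U, chi f f0 t x u.1 v.1 s)
    {σ : En n → ℝ} {V : ℝ → En n → ℝ}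
    (hHJI : ∀ t ∈ Set.Ico (0:ℝ) T, ∀ x : En n,
      deriv (fun r => V r x) t + ham U Vs f f0 t x (gradient (V t) x) = 0)
    (hVT : ∀ x : En n, V T x = σ x) {m j : ℕ} {ts : ℕ → ℝ}
    (hT : m < j → ts j = T) (hj : j ≤ m → ts j ∈ Set.Ico (0:ℝ) T)
    (hlt : j ≤ m → ts j < ts (j + 1)) (x : En n) :
    ⨆ v' : Vs, ⨅ u' : U, Qdelta f f0 σ V ts m j x u'.1 v'.1 = V (ts j) x := by
  have : Nonempty U := hUne.to_subtype
  have : Nonempty Vs := hVne.to_subtype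
  by_cases hjm : j ≤ m
  · simp only [Qdelta, if_pos hjm]
    set s := gradient (V (ts j)) x
    set t := ts j
    have hcont : Continuous fun q : En k × En l => chi f f0 t x q.1 q.2 s := by
      have e1 : Continuous fun q : En k × En l => (t, x, q.1, q.2) := by fun_prop
      exact ((hf.comp e1).inner continuous_const).add (hf0.comp e1)
    obtain ⟨C, hC⟩ := (hUc.prod hVc).exists_bound_of_continuousOn hcont.continuousOn
    have hb : ∀ (v : Vs) (u : U), |chi f f0 t x u.1 v.1 s| ≤ C :=
      fun v u => hC (u.1, v.1) ⟨u.2, v.2⟩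
    have e := iSup_iInf_add_mul hb
      (V t x + (ts (j + 1) - t) * deriv (fun r => V r x) t) (ts (j + 1) - t)
      (sub_nonneg.2 (hlt hjm).le)
    have h0 := hHJI t (hj hjm) x
    rw [ham, hIsaacs t (Set.Ico_subset_Icc_self (hj hjm))] at h0
    simp only [mul_add, ← add_assoc]
    rw [e, add_assoc, ← mul_add, h0, mul_zero, add_zero]
  · simp only [Qdelta, if_neg hjm, ciInf_const, ciSup_const]
    rw [hT (not_le.1 hjm), hVT]

theorem stmt_1
    (n k l : ℕ) (hn : 0 < n) (hk : 0 < k) (hl : 0 < l)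
    (T : ℝ) (hT : 0 < T)
    (U : Set (En k)) (Vs : Set (En l))
    (hUc : IsCompact U) (hUne : U.Nonempty) (hVc : IsCompact Vs) (hVne : Vs.Nonempty)
    (f : ℝ → En n → En k → En l → En n) (f0 : ℝ → En n → En k → En l → ℝ)
    (hf : Continuous fun p : ℝ × En n × En k × En l => f p.1 p.2.1 p.2.2.1 p.2.2.2)
    (hf0 : Continuous fun p : ℝ × En n × En k × En l => f0 p.1 p.2.1 p.2.2.1 p.2.2.2)
    (hIsaacs : ∀ t ∈ Set.Icc (0:ℝ) T, ∀ x s : En n,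
      (⨅ u : U, ⨆ v : Vs, chi f f0 t x u.1 v.1 s) =
        ⨆ v : Vs, ⨅ u : U, chi f f0 t x u.1 v.1 s)
    (σ : En n → ℝ) (hσ : Continuous σ)
    (V : ℝ → En n → ℝ) (hV : ContDiff ℝ 1 (Function.uncurry V))
    (hHJI : ∀ t ∈ Set.Ico (0:ℝ) T, ∀ x : En n,
      deriv (fun r => V r x) t + ham U Vs f f0 t x (gradient (V t) x) = 0)
    (hVT : ∀ x : En n, V T x = σ x)
    (τ : ℝ) (hτ0 : 0 ≤ τ) (hτT : τ < T)
    (D : Set (En n)) (hD : IsCompact D) (ε : ℝ) (hε : 0 < ε) :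
    ∃ δ > 0, ∀ (m : ℕ) (ts : ℕ → ℝ),
      ts 0 = τ → ts (m + 1) = T → (∀ i ≤ m, ts i < ts (i + 1)) →
      (∀ i ≤ m, ts (i + 1) - ts i ≤ δ) →
      ∀ i ≤ m, ∀ x ∈ D, ∀ u ∈ U, ∀ v ∈ Vs,
        |Qdelta f f0 σ V ts m i x u v - (ts (i + 1) - ts i) * f0 (ts i) x u v -
            ⨆ v' : Vs, ⨅ u' : U,
              Qdelta f f0 σ V ts m (i + 1)
                (x + (ts (i + 1) - ts i) • f (ts i) x u v) u'.1 v'.1| ≤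
          (ts (i + 1) - ts i) * ε := by
  obtain ⟨M, hM⟩ := ((isCompact_Icc (a := (0:ℝ)) (b := T)).prod
    (hD.prod (hUc.prod hVc))).exists_bound_of_continuousOn hf.continuousOn
  set M' : ℝ := 1 + |M|
  have hM'0 : 0 < M' := by positivity
  obtain ⟨ρ, hρ, hρV⟩ := hV.exists_uniform_taylor_bound
    ((isCompact_Icc (a := (0:ℝ)) (b := T)).prod hD) (div_pos hε hM'0)
  refine ⟨ρ / (2 * M'), by positivity, ?_⟩
  intro m ts h0 hend hlt hmesh i hi x hx u hu v hv
  have hlow : ∀ j ≤ m + 1, τ ≤ ts j := by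
    intro j
    induction j with
    | zero => intro _; exact h0.ge
    | succ j ih => intro hj; exact (ih (by omega)).trans (hlt j (by omega)).le
  have hup : ∀ j ≤ m, ts j < T := by
    intro j hj
    induction hj using Nat.decreasingInduction with
    | of_succ j hjm ih => exact (hlt j hjm.le).trans ih
    | self => exact hend ▸ hlt m le_rfl
  rw [iSup_iInf_Qdelta hUc hUne hVc hVne hf hf0 hIsaacs hHJI hVT
    (fun h => by rw [show i + 1 = m + 1 by omega, hend])
    (fun h => ⟨hτ0.trans (hlow _ (by omega)), hup _ h⟩) (fun h => hlt _ h)]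
  have hti : ts i ∈ Set.Icc (0:ℝ) T := ⟨hτ0.trans (hlow _ (by omega)), (hup i hi).le⟩
  have hw : ‖f (ts i) x u v‖ ≤ M := hM (ts i, x, u, v) ⟨hti, hx, hu, hv⟩
  set w := f (ts i) x u v
  set c := ts (i + 1) - ts i with hc
  have hc0 : 0 < c := sub_pos.2 (hlt i hi)
  have hh : ‖((c, c • w) : ℝ × En n)‖ ≤ c * M' := by
    refine norm_prod_le_iff.2 ⟨?_, ?_⟩
    · rw [Real.norm_of_nonneg hc0.le]
      exact le_mul_of_one_le_right hc0.le (le_add_of_nonneg_right (abs_nonneg M))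
    · rw [norm_smul, Real.norm_of_nonneg hc0.le]
      exact mul_le_mul_of_nonneg_left (by linarith [le_abs_self M]) hc0.le
  have hcρ : c * M' < ρ := by
    have h1 : c * M' ≤ ρ / (2 * M') * M' := mul_le_mul_of_nonneg_right (hmesh i hi) hM'0.le
    have h2 : ρ / (2 * M') * M' = ρ / 2 := by field_simp
    linarith
  have key := hρV (ts i, x) ⟨hti, hx⟩ (c, c • w) (hh.trans_lt hcρ)
  rw [fderiv_uncurry_apply_smul (hV.differentiable one_ne_zero _), Prod.mk_add_mk,
    show ts i + c = ts (i + 1) by rw [hc]; ring, Real.norm_eq_abs] at key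
  simp only [Function.uncurry_apply_pair] at key
  have hfin : ε / M' * ‖((c, c • w) : ℝ × En n)‖ ≤ c * ε :=
    (mul_le_mul_of_nonneg_left hh (by positivity)).trans_eq (by field_simp)
  refine le_of_eq_of_le ?_ (key.trans hfin)
  rw [← abs_neg, Qdelta, if_pos hi, chi]
  congr 1
  ring
end
end

section
/- For every w ∈ ℝ^n and every sequence v_0,…,v_m ∈ 𝒱, define the trajectory x_0 = w, x_{i+1} = x_i + Δt_i f(t_i, x_i, π_u(t_i,x_i), v_i) for i = 0,…,m. Then σ(x_{m+1}) + Σ_{i=0}^{m} Δt_i f⁰(t_i, x_i, π_u(t_i,x_i), v_i) ≤ inf_{u∈𝒰} sup_{v∈𝒱} Q(t_0, w, u, v) + ε(T − τ). -/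
open scoped RealInnerProductSpace

noncomputable section

theorem stmt_4
    (n k l : ℕ) (hn : 0 < n) (hk : 0 < k) (hl : 0 < l)
    (τ T : ℝ) (hτ0 : 0 ≤ τ) (hτT : τ < T)
    (U : Set (En k)) (Vs : Set (En l))
    (hUc : IsCompact U) (hUne : U.Nonempty) (hVc : IsCompact Vs) (hVne : Vs.Nonempty)
    (f : ℝ → En n → En k → En l → En n) (f0 : ℝ → En n → En k → En l → ℝ)
    (hf : Continuous fun p : ℝ × En n × En k × En l => f p.1 p.2.1 p.2.2.1 p.2.2.2)
    (hf0 : Continuous fun p : ℝ × En n × En k × En l => f0 p.1 p.2.1 p.2.2.1 p.2.2.2)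
    (σ : En n → ℝ) (hσ : Continuous σ)
    (ε : ℝ) (hε : 0 < ε)
    (m : ℕ) (ts : ℕ → ℝ)
    (hts0 : ts 0 = τ) (htsT : ts (m + 1) = T) (hmono : ∀ i ≤ m, ts i < ts (i + 1))
    (Q : ℕ → En n → En k → En l → ℝ)
    (hQcont : ∀ i ≤ m + 1, ContinuousOn
      (fun p : En n × En k × En l => Q i p.1 p.2.1 p.2.2) (Set.univ ×ˢ U ×ˢ Vs))
    (hQterm : ∀ x : En n, ∀ u ∈ U, ∀ v ∈ Vs, Q (m + 1) x u v = σ x)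
    (hQbellman : ∀ i ≤ m, ∀ x : En n, ∀ u ∈ U, ∀ v ∈ Vs,
      |Q i x u v - (ts (i + 1) - ts i) * f0 (ts i) x u v -
          ⨅ u' : U, ⨆ v' : Vs,
            Q (i + 1) (x + (ts (i + 1) - ts i) • f (ts i) x u v) u'.1 v'.1| ≤
        (ts (i + 1) - ts i) * ε)
    (πu : ℕ → En n → En k)
    (hπmem : ∀ i ≤ m, ∀ x : En n, πu i x ∈ U)
    (hgreedy : ∀ i ≤ m, ∀ x : En n,
      (⨆ v : Vs, Q i x (πu i x) v.1) = ⨅ u : U, ⨆ v : Vs, Q i x u.1 v.1) :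
    ∀ w : En n, ∀ vs : ℕ → En l, (∀ i ≤ m, vs i ∈ Vs) →
      ∀ xs : ℕ → En n, xs 0 = w →
        (∀ i ≤ m, xs (i + 1) =
          xs i + (ts (i + 1) - ts i) • f (ts i) (xs i) (πu i (xs i)) (vs i)) →
        σ (xs (m + 1)) +
            ∑ i ∈ Finset.range (m + 1),
              (ts (i + 1) - ts i) * f0 (ts i) (xs i) (πu i (xs i)) (vs i) ≤
          (⨅ u : U, ⨆ v : Vs, Q 0 w u.1 v.1) + ε * (T - τ) := by
  intro w vs hvs xs hxs0 hstep
  have : Nonempty U := hUne.to_subtype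
  have : Nonempty Vs := hVne.to_subtype
  have hle : ∀ i ≤ m, Q i (xs i) (πu i (xs i)) (vs i) ≤
      ⨅ u : U, ⨆ v : Vs, Q i (xs i) u.1 v.1 := by
    intro i hi
    rw [← hgreedy i hi]
    have hbdd : BddAbove (Set.range fun v : Vs => Q i (xs i) (πu i (xs i)) v.1) := by
      have hcont : ContinuousOn (fun v => Q i (xs i) (πu i (xs i)) v) Vs :=
        (hQcont i (by lia)).comp
          (f := fun v : En l => (xs i, πu i (xs i), v)) (by fun_prop)
          fun v hv => ⟨trivial, hπmem i hi _, hv⟩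
      simpa only [Set.image_eq_range] using hVc.bddAbove_image hcont
    exact le_ciSup hbdd ⟨vs i, hvs i hi⟩
  have hvalue : ∀ j ≤ m + 1, (⨅ u : U, ⨆ v : Vs, Q j (xs j) u.1 v.1) +
      ∑ i ∈ Finset.range j,
        (ts (i + 1) - ts i) * f0 (ts i) (xs i) (πu i (xs i)) (vs i) ≤
      (⨅ u : U, ⨆ v : Vs, Q 0 w u.1 v.1) + ε * (ts j - ts 0) := by
    intro j
    induction j with
    | zero => simp [hxs0]
    | succ j ih =>
      intro hj
      have hjm : j ≤ m := by lia
      have hbell := (abs_le.mp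
        (hQbellman j hjm (xs j) _ (hπmem j hjm (xs j)) _ (hvs j hjm))).1
      rw [← hstep j hjm] at hbell
      rw [Finset.sum_range_succ]
      linarith [ih (by lia), hle j hjm]
  have hterm : (⨅ u : U, ⨆ v : Vs, Q (m + 1) (xs (m + 1)) u.1 v.1) = σ (xs (m + 1)) := by
    simp [hQterm]
  simpa only [hterm, hts0, htsT] using hvalue (m + 1) le_rfl
end
end

section
/- For every w ∈ ℝ^n and every sequence u_0,…,u_m ∈ 𝒰, define the trajectory x_0 = w, x_{i+1} = x_i + Δt_i f(t_i, x_i, u_i, π_v(t_i,x_i)) for i = 0,…,m. Then σ(x_{m+1}) + Σ_{i=0}^{m} Δt_i f⁰(t_i, x_i, u_i, π_v(t_i,x_i)) ≥ sup_{v∈𝒱} inf_{u∈𝒰} Q(t_0, w, u, v) − ε(T − τ). -/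
open scoped RealInnerProductSpace

noncomputable section

theorem stmt_5
    (n k l : ℕ) (hn : 0 < n) (hk : 0 < k) (hl : 0 < l)
    (τ T : ℝ) (hτ0 : 0 ≤ τ) (hτT : τ < T)
    (U : Set (En k)) (Vs : Set (En l))
    (hUc : IsCompact U) (hUne : U.Nonempty) (hVc : IsCompact Vs) (hVne : Vs.Nonempty)
    (f : ℝ → En n → En k → En l → En n) (f0 : ℝ → En n → En k → En l → ℝ)
    (hf : Continuous fun p : ℝ × En n × En k × En l => f p.1 p.2.1 p.2.2.1 p.2.2.2)
    (hf0 : Continuous fun p : ℝ × En n × En k × En l => f0 p.1 p.2.1 p.2.2.1 p.2.2.2)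
    (σ : En n → ℝ) (hσ : Continuous σ)
    (ε : ℝ) (hε : 0 < ε)
    (m : ℕ) (ts : ℕ → ℝ)
    (hts0 : ts 0 = τ) (htsT : ts (m + 1) = T) (hmono : ∀ i ≤ m, ts i < ts (i + 1))
    (Q : ℕ → En n → En k → En l → ℝ)
    (hQcont : ∀ i ≤ m + 1, ContinuousOn
      (fun p : En n × En k × En l => Q i p.1 p.2.1 p.2.2) (Set.univ ×ˢ U ×ˢ Vs))
    (hQterm : ∀ x : En n, ∀ u ∈ U, ∀ v ∈ Vs, Q (m + 1) x u v = σ x)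
    (hQbellman : ∀ i ≤ m, ∀ x : En n, ∀ u ∈ U, ∀ v ∈ Vs,
      |Q i x u v - (ts (i + 1) - ts i) * f0 (ts i) x u v -
          ⨆ v' : Vs, ⨅ u' : U,
            Q (i + 1) (x + (ts (i + 1) - ts i) • f (ts i) x u v) u'.1 v'.1| ≤
        (ts (i + 1) - ts i) * ε)
    (πv : ℕ → En n → En l)
    (hπmem : ∀ i ≤ m, ∀ x : En n, πv i x ∈ Vs)
    (hgreedy : ∀ i ≤ m, ∀ x : En n,
      (⨅ u : U, Q i x u.1 (πv i x)) = ⨆ v : Vs, ⨅ u : U, Q i x u.1 v.1) :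
    ∀ w : En n, ∀ us : ℕ → En k, (∀ i ≤ m, us i ∈ U) →
      ∀ xs : ℕ → En n, xs 0 = w →
        (∀ i ≤ m, xs (i + 1) =
          xs i + (ts (i + 1) - ts i) • f (ts i) (xs i) (us i) (πv i (xs i))) →
        σ (xs (m + 1)) +
            ∑ i ∈ Finset.range (m + 1),
              (ts (i + 1) - ts i) * f0 (ts i) (xs i) (us i) (πv i (xs i)) ≥
          (⨆ v : Vs, ⨅ u : U, Q 0 w u.1 v.1) - ε * (T - τ) := by
  intro w us hus xs hx0 hxs
  have : Nonempty U := hUne.to_subtype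
  have : Nonempty Vs := hVne.to_subtype
  have hbdd : ∀ i ≤ m, ∀ x : En n, ∀ v ∈ Vs,
      BddBelow (Set.range fun u : U => Q i x u.1 v) := by
    intro i hi x v hv
    have hc : ContinuousOn (fun u => Q i x u v) U :=
      (hQcont i (by omega)).comp (f := fun u : En k => (x, u, v))
        (by fun_prop) (fun u hu => ⟨Set.mem_univ _, hu, hv⟩)
    have hb := hUc.bddBelow_image hc
    rwa [Set.image_eq_range] at hb
  have htelescope : ∀ j ≤ m + 1, (⨆ v : Vs, ⨅ u : U, Q 0 w u.1 v.1) ≤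
      (⨆ v : Vs, ⨅ u : U, Q j (xs j) u.1 v.1) +
        ∑ i ∈ Finset.range j, (ts (i + 1) - ts i) * f0 (ts i) (xs i) (us i) (πv i (xs i)) +
        ε * (ts j - ts 0) := by
    intro j
    induction j with
    | zero => intro _; simp [hx0]
    | succ j ih =>
      intro hj
      have hjm : j ≤ m := by omega
      have hprev := ih (by omega)
      have hinf := ciInf_le (hbdd j hjm (xs j) _ (hπmem j hjm (xs j))) ⟨us j, hus j hjm⟩
      rw [hgreedy j hjm] at hinf
      have hstep := (abs_le.mp (hQbellman j hjm (xs j) _ (hus j hjm) _ (hπmem j hjm (xs j)))).2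
      rw [← hxs j hjm] at hstep
      rw [Finset.sum_range_succ]
      linarith
  have hfinal : (⨆ v : Vs, ⨅ u : U, Q (m + 1) (xs (m + 1)) u.1 v.1) = σ (xs (m + 1)) := by
    simp only [fun (v : Vs) (u : U) => hQterm (xs (m + 1)) u.1 u.2 v.1 v.2, ciInf_const,
      ciSup_const]
  have := htelescope (m + 1) le_rfl
  rw [hfinal, hts0, htsT] at this
  linarith
end
end

section
/- For every (τ,w) ∈ [0,T) × ℝ^n and every ε > 0 there exists δ > 0 such that for every partition Δ of [τ,T] with d(Δ) ≤ δ and every sequence v_0,…,v_m ∈ 𝒱, the trajectory x_0 = w, x_{i+1} = x_i + Δt_i f(t_i,x_i,π_u(t_i,x_i),v_i) satisfies σ(x_{m+1}) + Σ_{i=0}^{m} Δt_i f⁰(t_i, x_i, π_u(t_i,x_i), v_i) ≤ V(τ,w) + ε T. -/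
open scoped RealInnerProductSpace

noncomputable section

/-- A `C¹` function has a first-order expansion that is uniform on compact convex sets. -/
theorem exists_uniform_taylor {E : Type*} [NormedAddCommGroup E] [NormedSpace ℝ E]
    {F : E → ℝ} (hF : ContDiff ℝ 1 F) {K : Set E} (hK : IsCompact K) (hKc : Convex ℝ K)
    {η : ℝ} (hη : 0 < η) :
    ∃ δ > 0, ∀ p ∈ K, ∀ q ∈ K, ‖q - p‖ < δ →
      ‖F q - F p - fderiv ℝ F p (q - p)‖ ≤ η * ‖q - p‖ := by
  have huc : UniformContinuousOn (fderiv ℝ F) K :=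
    hK.uniformContinuousOn_of_continuous (hF.continuous_fderiv one_ne_zero).continuousOn
  obtain ⟨δ, hδ, h⟩ := Metric.uniformContinuousOn_iff.1 huc η hη
  refine ⟨δ, hδ, fun p hp q hq hpq => ?_⟩
  refine (convex_segment p q).norm_image_sub_le_of_norm_hasFDerivWithin_le'
    (f' := fderiv ℝ F) (fun x _ => ((hF.differentiable one_ne_zero) x).hasFDerivAt.hasFDerivWithinAt)
    (fun x hx => ?_) (left_mem_segment ℝ p q) (right_mem_segment ℝ p q)
  rw [← dist_eq_norm]
  refine (h x (hKc.segment_subset hp hq hx) p hp ?_).le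
  have hx' := segment_subset_closedBall_left p q hx
  rw [Metric.mem_closedBall, dist_comm p q, dist_eq_norm q p] at hx'
  exact hx'.trans_lt hpq

/-- The total derivative in the direction `(1, y)` splits into time and space derivatives. -/
theorem fderiv_uncurry_one_apply {n : ℕ} {V : ℝ → En n → ℝ}
    (hV : Differentiable ℝ (Function.uncurry V)) (t : ℝ) (x y : En n) :
    fderiv ℝ (Function.uncurry V) (t, x) (1, y) =
      deriv (fun r => V r x) t + ⟪y, gradient (V t) x⟫ := by
  have h := (hV (t, x)).hasFDerivAt
  have ht : HasDerivAt (fun r => V r x) (fderiv ℝ (Function.uncurry V) (t, x) (1, 0)) t :=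
    HasFDerivAt.comp_hasDerivAt (f := fun r : ℝ => (r, x)) t h
      ((hasDerivAt_id t).prodMk (hasDerivAt_const t x))
  have hx : HasFDerivAt (V t) ((fderiv ℝ (Function.uncurry V) (t, x)).comp
      (ContinuousLinearMap.inr ℝ ℝ (En n))) x :=
    HasFDerivAt.comp (f := fun z : En n => (t, z)) x h (hasFDerivAt_prodMk_right t x)
  rw [ht.deriv, real_inner_comm, gradient, InnerProductSpace.toDual_symm_apply, hx.fderiv,
    ContinuousLinearMap.comp_apply, ContinuousLinearMap.inr_apply, ← map_add]
  simp

/-- Discrete Grönwall bound for Euler steps of a map with linear growth. -/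
theorem euler_growth_bound {E : Type*} [NormedAddCommGroup E] [NormedSpace ℝ E]
    {c : ℝ} {N : ℕ} {ts : ℕ → ℝ} {xs g : ℕ → E}
    (hts : ∀ i < N, ts i ≤ ts (i + 1))
    (hx : ∀ i < N, xs (i + 1) = xs i + (ts (i + 1) - ts i) • g i)
    (hg : ∀ i < N, ‖g i‖ ≤ c * (1 + ‖xs i‖)) :
    ∀ i ≤ N, 1 + ‖xs i‖ ≤ (1 + ‖xs 0‖) * Real.exp (c * (ts i - ts 0)) := by
  intro i
  induction i with
  | zero => simp
  | succ i ih =>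
    intro hi
    have hd : 0 ≤ ts (i + 1) - ts i := sub_nonneg.2 (hts i hi)
    calc 1 + ‖xs (i + 1)‖
        ≤ 1 + (‖xs i‖ + (ts (i + 1) - ts i) * ‖g i‖) := by
          rw [hx i hi]
          gcongr
          refine (norm_add_le _ _).trans_eq ?_
          rw [norm_smul, Real.norm_of_nonneg hd]
      _ ≤ 1 + (‖xs i‖ + (ts (i + 1) - ts i) * (c * (1 + ‖xs i‖))) := by
          gcongr
          exact hg i hi
      _ = (1 + ‖xs i‖) * (c * (ts (i + 1) - ts i) + 1) := by ring
      _ ≤ (1 + ‖xs i‖) * Real.exp (c * (ts (i + 1) - ts i)) := by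
          gcongr
          exact Real.add_one_le_exp _
      _ ≤ (1 + ‖xs 0‖) * Real.exp (c * (ts i - ts 0)) * Real.exp (c * (ts (i + 1) - ts i)) := by
          gcongr
          exact ih (Nat.le_of_succ_le hi)
      _ = (1 + ‖xs 0‖) * Real.exp (c * (ts (i + 1) - ts 0)) := by
          rw [mul_assoc, ← Real.exp_add]
          ring_nf

/-- Under a bound on the dynamics and the running cost, `chi` is dominated by its supremum. -/
theorem chi_le_iSup {n k l : ℕ} {Vs : Set (En l)} {f : ℝ → En n → En k → En l → En n}
    {f0 : ℝ → En n → En k → En l → ℝ} {t : ℝ} {x : En n} {u : En k} {C : ℝ}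
    (hC : ∀ v ∈ Vs, ‖f t x u v‖ + |f0 t x u v| ≤ C) (s : En n) {v : En l} (hv : v ∈ Vs) :
    chi f f0 t x u v s ≤ ⨆ v : Vs, chi f f0 t x u v.1 s := by
  refine le_ciSup (f := fun v : Vs => chi f f0 t x u v.1 s) ⟨C * ‖s‖ + C, ?_⟩ ⟨v, hv⟩
  rintro _ ⟨⟨v', hv'⟩, rfl⟩
  have h := hC v' hv'
  refine add_le_add ((real_inner_le_norm _ _).trans ?_) ?_
  · gcongr
    linarith [abs_nonneg (f0 t x u v')]
  · linarith [le_abs_self (f0 t x u v'), norm_nonneg (f t x u v')]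

theorem stmt_6
    (n k l : ℕ) (hn : 0 < n) (hk : 0 < k) (hl : 0 < l)
    (T : ℝ) (hT : 0 < T)
    (U : Set (En k)) (Vs : Set (En l))
    (hUc : IsCompact U) (hUne : U.Nonempty) (hVc : IsCompact Vs) (hVne : Vs.Nonempty)
    (f : ℝ → En n → En k → En l → En n) (f0 : ℝ → En n → En k → En l → ℝ)
    (hf : Continuous fun p : ℝ × En n × En k × En l => f p.1 p.2.1 p.2.2.1 p.2.2.2)
    (hf0 : Continuous fun p : ℝ × En n × En k × En l => f0 p.1 p.2.1 p.2.2.1 p.2.2.2)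
    (σ : En n → ℝ) (hσ : Continuous σ)
    (V : ℝ → En n → ℝ) (hV : ContDiff ℝ 1 (Function.uncurry V))
    (hHJI : ∀ t ∈ Set.Ico (0:ℝ) T, ∀ x : En n,
      deriv (fun r => V r x) t + ham U Vs f f0 t x (gradient (V t) x) = 0)
    (hVT : ∀ x : En n, V T x = σ x)
    (c_f : ℝ) (hcf : 0 < c_f)
    (hgrowth : ∀ t ∈ Set.Icc (0:ℝ) T, ∀ x : En n, ∀ u ∈ U, ∀ v ∈ Vs,
      ‖f t x u v‖ + |f0 t x u v| ≤ c_f * (1 + ‖x‖))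
    (πu : ℝ → En n → En k)
    (hπmem : ∀ t ∈ Set.Icc (0:ℝ) T, ∀ x : En n, πu t x ∈ U)
    (hgreedy : ∀ t ∈ Set.Icc (0:ℝ) T, ∀ x : En n,
      (⨆ v : Vs, chi f f0 t x (πu t x) v.1 (gradient (V t) x)) =
        ham U Vs f f0 t x (gradient (V t) x)) :
    ∀ τ : ℝ, 0 ≤ τ → τ < T → ∀ w : En n, ∀ ε : ℝ, 0 < ε →
      ∃ δ > 0, ∀ (m : ℕ) (ts : ℕ → ℝ),
        ts 0 = τ → ts (m + 1) = T → (∀ i ≤ m, ts i < ts (i + 1)) →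
        (∀ i ≤ m, ts (i + 1) - ts i ≤ δ) →
        ∀ vs : ℕ → En l, (∀ i ≤ m, vs i ∈ Vs) →
          ∀ xs : ℕ → En n, xs 0 = w →
            (∀ i ≤ m, xs (i + 1) = xs i +
              (ts (i + 1) - ts i) • f (ts i) (xs i) (πu (ts i) (xs i)) (vs i)) →
            σ (xs (m + 1)) +
                ∑ i ∈ Finset.range (m + 1),
                  (ts (i + 1) - ts i) * f0 (ts i) (xs i) (πu (ts i) (xs i)) (vs i) ≤
              V τ w + ε * T := by
  intro τ hτ0 hτT w ε hε
  set R : ℝ := (1 + ‖w‖) * Real.exp (c_f * T) with hR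
  have hRpos : 0 < R := by positivity
  set M : ℝ := 1 + c_f * R with hM
  have hMpos : 0 < M := by positivity
  obtain ⟨δ, hδ, htaylor⟩ := exists_uniform_taylor hV
    (K := Set.Icc 0 T ×ˢ Metric.closedBall (0 : En n) R)
    (isCompact_Icc.prod (isCompact_closedBall _ _))
    ((convex_Icc _ _).prod (convex_closedBall _ _)) (div_pos hε hMpos)
  refine ⟨δ / (2 * M), by positivity, ?_⟩
  intro m ts hts0 htsT hts hmesh vs hvs xs hxs0 hxs
  have hmono : ∀ i j, i + j ≤ m + 1 → ts i ≤ ts (i + j) := by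
    intro i j
    induction j with
    | zero => simp
    | succ j ih => exact fun h => (ih (by omega)).trans (hts (i + j) (by omega)).le
  have htτ : ∀ i ≤ m + 1, τ ≤ ts i := fun i hi => by
    simpa [hts0] using hmono 0 i (by omega)
  have htT : ∀ i ≤ m + 1, ts i ≤ T := fun i hi => by
    have h := hmono i (m + 1 - i) (by omega)
    rwa [Nat.add_sub_cancel' hi, htsT] at h
  have htI : ∀ i ≤ m + 1, ts i ∈ Set.Icc 0 T := fun i hi => ⟨hτ0.trans (htτ i hi), htT i hi⟩
  have hgr : ∀ i ≤ m, ∀ v ∈ Vs, ‖f (ts i) (xs i) (πu (ts i) (xs i)) v‖ +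
      |f0 (ts i) (xs i) (πu (ts i) (xs i)) v| ≤ c_f * (1 + ‖xs i‖) := fun i hi v hv =>
    hgrowth _ (htI i (by omega)) _ _ (hπmem _ (htI i (by omega)) _) v hv
  have hfb : ∀ i ≤ m, ‖f (ts i) (xs i) (πu (ts i) (xs i)) (vs i)‖ ≤ c_f * (1 + ‖xs i‖) :=
    fun i hi => (le_add_of_nonneg_right (abs_nonneg _)).trans (hgr i hi _ (hvs i hi))
  have hxR : ∀ i ≤ m + 1, 1 + ‖xs i‖ ≤ R := fun i hi => by
    refine (euler_growth_bound (c := c_f) (N := m + 1)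
      (g := fun i => f (ts i) (xs i) (πu (ts i) (xs i)) (vs i))
      (fun i hi => (hts i (by omega)).le) (fun i hi => hxs i (by omega))
      (fun i hi => hfb i (by omega)) i hi).trans ?_
    rw [hxs0, hts0, hR]
    gcongr
    linarith [htT i hi]
  have hmem : ∀ i ≤ m + 1, (ts i, xs i) ∈ Set.Icc 0 T ×ˢ Metric.closedBall (0 : En n) R :=
    fun i hi => ⟨htI i hi, by
      rw [mem_closedBall_zero_iff]
      linarith [hxR i hi]⟩
  have hstep : ∀ i ≤ m, V (ts (i + 1)) (xs (i + 1)) +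
      (ts (i + 1) - ts i) * f0 (ts i) (xs i) (πu (ts i) (xs i)) (vs i) ≤
        V (ts i) (xs i) + ε * (ts (i + 1) - ts i) := by
    intro i hi
    set d : ℝ := ts (i + 1) - ts i with hd
    have hdpos : 0 < d := sub_pos.2 (hts i hi)
    set y := f (ts i) (xs i) (πu (ts i) (xs i)) (vs i) with hy
    have hsub : (ts (i + 1), xs (i + 1)) - (ts i, xs i) = d • ((1 : ℝ), y) := by
      rw [hxs i hi]
      simp [hd, hy]
    have hyM : ‖((1 : ℝ), y)‖ ≤ M := by
      have h1 : ‖y‖ ≤ c_f * R := (hfb i hi).trans (by gcongr; exact hxR i (by omega))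
      rw [Prod.norm_mk, norm_one]
      exact max_le (by rw [hM]; linarith [mul_pos hcf hRpos]) (by rw [hM]; linarith)
    have hnorm : ‖d • ((1 : ℝ), y)‖ ≤ d * M := by
      rw [norm_smul, Real.norm_of_nonneg hdpos.le]
      gcongr
    have hsmall : d * M < δ := by
      have h := hmesh i hi
      rw [le_div_iff₀ (by positivity)] at h
      linarith
    have hT' := htaylor _ (hmem i (by omega)) _ (hmem (i + 1) (by omega))
      (by rw [hsub]; exact hnorm.trans_lt hsmall)
    rw [hsub, map_smul, smul_eq_mul,
      fderiv_uncurry_one_apply (hV.differentiable one_ne_zero)] at hT'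
    have hη : ε / M * ‖d • ((1 : ℝ), y)‖ ≤ ε * d := by
      calc ε / M * ‖d • ((1 : ℝ), y)‖ ≤ ε / M * (d * M) := by gcongr
        _ = ε * d := by field_simp
    have hle := (Real.le_norm_self _).trans (hT'.trans hη)
    simp only [Function.uncurry_apply_pair] at hle
    have hchi := chi_le_iSup (hgr i hi) (gradient (V (ts i)) (xs i)) (hvs i hi)
    rw [hgreedy _ (htI i (by omega)), chi, ← hy] at hchi
    have hpde := hHJI (ts i) ⟨(htI i (by omega)).1,
      (hts i hi).trans_le (htT (i + 1) (by omega))⟩ (xs i)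
    have hdrop := mul_le_mul_of_nonneg_left hchi hdpos.le
    rw [eq_neg_of_add_eq_zero_left hpde] at hle
    linarith
  have hsum : ∀ j ≤ m + 1, V (ts j) (xs j) + ∑ i ∈ Finset.range j,
      (ts (i + 1) - ts i) * f0 (ts i) (xs i) (πu (ts i) (xs i)) (vs i) ≤
        V τ w + ε * (ts j - τ) := by
    intro j
    induction j with
    | zero => simp [hts0, hxs0]
    | succ j ih =>
      intro hj
      rw [Finset.sum_range_succ]
      linarith [ih (by omega), hstep j (by omega)]
  have hfin := hsum (m + 1) le_rfl
  rw [htsT, hVT] at hfin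
  linarith [mul_nonneg hε.le hτ0]
end
end
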